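/- Let H be an infinite-dimensional complex Hilbert space and let F be a convex regular map of k-tuples of positive definite invertible bounded operators on H into self-adjoint bounded operators on H. Then its perspective P_F(A₁,…,Aₖ,B) = B^{1/2} F(B^{−1/2}A₁B^{−1/2}, …, B^{−1/2}AₖB^{−1/2}) B^{1/2} is convex: for all (k+1)-tuples (A₁,…,A_{k+1}) and (B₁,…,B_{k+1}) of positive definite invertible operators and all λ ∈ [0,1], P_F(λA₁+(1−λ)B₁, …, λA_{k+1}+(1−λ)B_{k+1}) ≤ λ P_F(A₁,…,A_{k+1}) + (1−λ) P_F(B₁,…,B_{k+1}) in the Loewner order. -/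

import Mathlib

set_option synthInstance.maxHeartbeats 400000
set_option maxHeartbeats 1000000

noncomputable section

variable {H : Type*} [NormedAddCommGroup H] [InnerProductSpace ℂ H] [CompleteSpace H]

/-- `a` is a positive definite invertible bounded operator. -/
def IsPosDefInv (a : H →L[ℂ] H) : Prop := 0 ≤ a ∧ IsUnit a

/-- `a` belongs to the compressed domain `D_p`: viewed as an operator on the range of the
projection `p`, it is positive definite and invertible, i.e. `a = p a p ≥ 0` and `a` is
invertible in the corner algebra `p B(H) p`. -/
def IsCornerPosDef (p a : H →L[ℂ] H) : Prop :=
  0 ≤ a ∧ p * a * p = a ∧ ∃ b : H →L[ℂ] H, p * b * p = b ∧ a * b = p ∧ b * a = p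

/-- A regular operator mapping of `k`-tuples of positive definite invertible bounded operators:
it is unitarily invariant and compatible with block diagonal decompositions with respect to
any pair of mutually orthogonal (self-adjoint idempotent) projections, the compressed tuples
lying in the compressed domains. -/
def IsRegularPD {k : ℕ} (F : (Fin k → (H →L[ℂ] H)) → (H →L[ℂ] H)) : Prop :=
  (∀ u ∈ unitary (H →L[ℂ] H), ∀ A : Fin k → (H →L[ℂ] H), (∀ i, IsPosDefInv (A i)) →
      F (fun i => star u * A i * u) = star u * F A * u) ∧
  (∀ p q : H →L[ℂ] H, IsSelfAdjoint p → IsIdempotentElem p →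
      IsSelfAdjoint q → IsIdempotentElem q → p * q = 0 →
      ∀ x y : Fin k → (H →L[ℂ] H),
        (∀ i, IsCornerPosDef p (p * x i * p)) → (∀ i, IsCornerPosDef q (q * y i * q)) →
        F (fun i => p * x i * p + q * y i * q) =
          p * F (fun i => p * x i * p) * p + q * F (fun i => q * y i * q) * q)

/-- The perspective of a mapping `F` of `k`-tuples:
`P_F(A₁,…,Aₖ,B) = B^{1/2} F(B^{-1/2}A₁B^{-1/2},…,B^{-1/2}AₖB^{-1/2}) B^{1/2}`, where
`B^{1/2}` is the positive square root of `B` and `B^{-1/2}` that of `B⁻¹`. -/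
noncomputable def perspective {k : ℕ} (F : (Fin k → (H →L[ℂ] H)) → (H →L[ℂ] H))
    (A : Fin k → (H →L[ℂ] H)) (B : H →L[ℂ] H) : H →L[ℂ] H :=
  CFC.sqrt B *
    F (fun i => CFC.sqrt (Ring.inverse B) * A i * CFC.sqrt (Ring.inverse B)) *
    CFC.sqrt B

section StarRing

variable {A : Type*} [Ring A]

/-- The element which is block diagonal with respect to `p` and `1 - p`, with blocks taken from
`x` and `w`. -/
def blockDiag (p x w : A) : A := p * x * p + (1 - p) * w * (1 - p)

theorem mul_mul_cancel_left_of_eq {a b c : A} (h : a * b = c) (z : A) : a * (b * z) = c * z := by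
  rw [← mul_assoc, h]

theorem blockDiag_compress {p : A} (hp : p * p = p) (x w : A) :
    p * blockDiag p x w * p = p * x * p := by
  have hp' := mul_mul_cancel_left_of_eq hp
  simp only [blockDiag, mul_add, add_mul, mul_sub, sub_mul, mul_assoc, hp, hp', one_mul, mul_one]
  abel

theorem commute_blockDiag {p : A} (hp : p * p = p) (x w : A) : Commute p (blockDiag p x w) := by
  have hp' := mul_mul_cancel_left_of_eq hp
  simp only [Commute, SemiconjBy, blockDiag, mul_add, add_mul, mul_sub, sub_mul, mul_assoc, hp,
    hp', one_mul, mul_one]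
  abel

theorem blockDiag_congr_left {p x x' : A} (h : p * x * p = p * x' * p) (w : A) :
    blockDiag p x w = blockDiag p x' w := by
  simp only [blockDiag, h]

theorem Commute.blockDiag_self {p x : A} (hp : p * p = p) (h : Commute p x) :
    blockDiag p x x = x := by
  have hp' := mul_mul_cancel_left_of_eq hp
  simp only [blockDiag, mul_sub, sub_mul, mul_assoc, ← h.eq, hp', one_mul, mul_one]
  abel

variable [StarRing A]

/-- The self-adjoint unitary exchanging the initial projection `p` and the final projection
`s * star s` of a partial isometry `s`. -/
def swapUnitary (p s : A) : A := s + star s + (1 - p - s * star s)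

/-- `s` is a partial isometry with initial projection `p`, whose final projection is orthogonal
to `p`. -/
structure IsOrthoPartialIsometry (p s : A) : Prop where
  star_mul_self : star s * s = p
  mul_initial : s * p = s
  initial_mul : p * s = 0

namespace IsOrthoPartialIsometry

variable {p s : A}

theorem star_initial (h : IsOrthoPartialIsometry p s) : star p = p := by
  rw [← h.star_mul_self, star_mul, star_star]

theorem initial_mul_self (h : IsOrthoPartialIsometry p s) : p * p = p := by
  nth_rewrite 1 [← h.star_mul_self]
  rw [mul_assoc, h.mul_initial, h.star_mul_self]

theorem initial_mul_star (h : IsOrthoPartialIsometry p s) : p * star s = star s := by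
  have := congrArg star h.mul_initial
  rwa [star_mul, h.star_initial] at this

theorem star_mul_initial (h : IsOrthoPartialIsometry p s) : star s * p = 0 := by
  have := congrArg star h.initial_mul
  rwa [star_mul, h.star_initial, star_zero] at this

theorem mul_self (h : IsOrthoPartialIsometry p s) : s * s = 0 := by
  nth_rewrite 1 [← h.mul_initial]
  rw [mul_assoc, h.initial_mul, mul_zero]

theorem star_mul_star (h : IsOrthoPartialIsometry p s) : star s * star s = 0 := by
  rw [← star_mul, h.mul_self, star_zero]

theorem star_swapUnitary (h : IsOrthoPartialIsometry p s) :
    star (swapUnitary p s) = swapUnitary p s := by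
  simp only [swapUnitary, star_add, star_sub, star_mul, star_star, star_one, h.star_initial]
  abel

theorem swapUnitary_mul_self (h : IsOrthoPartialIsometry p s) :
    swapUnitary p s * swapUnitary p s = 1 := by
  simp only [swapUnitary, mul_add, add_mul, mul_sub, sub_mul, mul_assoc, one_mul, mul_one,
    h.star_mul_self, h.mul_initial, h.initial_mul, h.initial_mul_self, h.initial_mul_star,
    h.star_mul_initial, h.mul_self, h.star_mul_star,
    mul_mul_cancel_left_of_eq h.star_mul_self, mul_mul_cancel_left_of_eq h.initial_mul,
    mul_mul_cancel_left_of_eq h.mul_self, zero_mul, mul_zero]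
  abel

theorem swapUnitary_mul_initial (h : IsOrthoPartialIsometry p s) : swapUnitary p s * p = s := by
  simp only [swapUnitary, add_mul, sub_mul, mul_assoc, one_mul, h.mul_initial,
    h.initial_mul_self, h.star_mul_initial, mul_zero]
  abel

theorem initial_mul_swapUnitary (h : IsOrthoPartialIsometry p s) :
    p * swapUnitary p s = star s := by
  have := congrArg star h.swapUnitary_mul_initial
  rwa [star_mul, h.star_swapUnitary, h.star_initial] at this

theorem swapUnitary_mem_unitary (h : IsOrthoPartialIsometry p s) :
    swapUnitary p s ∈ unitary A := by
  rw [Unitary.mem_iff, h.star_swapUnitary]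
  exact ⟨h.swapUnitary_mul_self, h.swapUnitary_mul_self⟩

theorem compress_swapUnitary_conj (h : IsOrthoPartialIsometry p s) (X : A) :
    p * (swapUnitary p s * X * swapUnitary p s) * p = star s * X * s := by
  calc _ = (p * swapUnitary p s) * X * (swapUnitary p s * p) := by simp only [mul_assoc]
    _ = _ := by rw [h.swapUnitary_mul_initial, h.initial_mul_swapUnitary]

theorem swapUnitary_mul (h : IsOrthoPartialIsometry p s) : swapUnitary p s * s = p := by
  calc swapUnitary p s * s = swapUnitary p s * (swapUnitary p s * p) := by
        rw [h.swapUnitary_mul_initial]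
    _ = p := by rw [← mul_assoc, h.swapUnitary_mul_self, one_mul]

end IsOrthoPartialIsometry

end StarRing

section Positivity

theorem isPosDefInv_iff {a : H →L[ℂ] H} :
    IsPosDefInv a ↔ ∃ m : ℝ, 0 < m ∧ m • (1 : H →L[ℂ] H) ≤ a := by
  constructor
  · rintro ⟨h0, hu⟩
    rcases subsingleton_or_nontrivial (H →L[ℂ] H) with h | h
    · exact ⟨1, one_pos, (Subsingleton.elim _ _).le⟩
    · have hs : IsStrictlyPositive a := ⟨h0, hu⟩
      obtain ⟨r, hr, h⟩ := (CFC.exists_pos_algebraMap_le_iff hs.isSelfAdjoint).2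
        fun x hx ↦ hs.spectrum_pos hx
      exact ⟨r, hr, by rwa [← Algebra.algebraMap_eq_smul_one]⟩
  · rintro ⟨m, hm, h⟩
    have hs : IsStrictlyPositive (algebraMap ℝ (H →L[ℂ] H) m) :=
      isStrictlyPositive_algebraMap hm
    rw [← Algebra.algebraMap_eq_smul_one] at h
    exact ⟨hs.1.trans h, CStarAlgebra.isUnit_of_le _ h hs⟩

theorem IsPosDefInv.isSelfAdjoint {a : H →L[ℂ] H} (ha : IsPosDefInv a) : IsSelfAdjoint a :=
  .of_nonneg ha.1

theorem isPosDefInv_one : IsPosDefInv (1 : H →L[ℂ] H) :=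
  ⟨zero_le_one, isUnit_one⟩

theorem IsPosDefInv.convex_comb {a b : H →L[ℂ] H} (ha : IsPosDefInv a) (hb : IsPosDefInv b)
    {s t : ℝ} (hs : 0 ≤ s) (ht : 0 ≤ t) (hst : s + t = 1) : IsPosDefInv (s • a + t • b) := by
  obtain ⟨m, hm, ha⟩ := isPosDefInv_iff.1 ha
  obtain ⟨n, hn, hb⟩ := isPosDefInv_iff.1 hb
  refine isPosDefInv_iff.2 ⟨s * m + t * n, ?_, ?_⟩
  · rcases hs.eq_or_lt with rfl | hs
    · obtain rfl : t = 1 := by linarith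
      simpa
    · positivity
  · rw [add_smul, mul_smul, mul_smul]
    exact add_le_add (smul_le_smul_of_nonneg_left ha hs) (smul_le_smul_of_nonneg_left hb ht)

theorem convex_isPosDefInv (k : ℕ) :
    Convex ℝ {A : Fin k → (H →L[ℂ] H) | ∀ i, IsPosDefInv (A i)} :=
  fun _ hA _ hB _ _ hs ht hst i ↦ (hA i).convex_comb (hB i) hs ht hst

/-- A sum of conjugates of positive definite invertible operators by the columns of an isometry
is positive definite and invertible. -/
theorem IsPosDefInv.star_conj_add {x y c d : H →L[ℂ] H} (hx : IsPosDefInv x) (hy : IsPosDefInv y)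
    (h : star c * c + star d * d = 1) : IsPosDefInv (star c * x * c + star d * y * d) := by
  obtain ⟨m, hm, hx⟩ := isPosDefInv_iff.1 hx
  obtain ⟨n, hn, hy⟩ := isPosDefInv_iff.1 hy
  refine isPosDefInv_iff.2 ⟨min m n, lt_min hm hn, ?_⟩
  have h1 : min m n • (1 : H →L[ℂ] H) ≤ x :=
    (smul_le_smul_of_nonneg_right (min_le_left m n) zero_le_one).trans hx
  have h2 : min m n • (1 : H →L[ℂ] H) ≤ y :=
    (smul_le_smul_of_nonneg_right (min_le_right m n) zero_le_one).trans hy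
  calc min m n • (1 : H →L[ℂ] H)
      = star c * (min m n • 1) * c + star d * (min m n • 1) * d := by
        simp only [mul_smul_comm, smul_mul_assoc, mul_one, ← smul_add, h]
    _ ≤ _ := add_le_add (star_left_conjugate_le_conjugate h1 c)
        (star_left_conjugate_le_conjugate h2 d)

theorem isPosDefInv_blockDiag {p x w : H →L[ℂ] H} (hp : IsStarProjection p)
    (hx : IsPosDefInv x) (hw : IsPosDefInv w) : IsPosDefInv (blockDiag p x w) := by
  have hs : star p = p := hp.isSelfAdjoint
  have hi : p * p = p := hp.isIdempotentElem
  have := hx.star_conj_add hw (c := p) (d := 1 - p) (by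
    simp only [star_sub, star_one, hs, mul_sub, sub_mul, hi, mul_one, one_mul]
    abel)
  simpa only [blockDiag, star_sub, star_one, hs] using this

theorem IsPosDefInv.unitary_conj {u x : H →L[ℂ] H} (hx : IsPosDefInv x)
    (hu : u ∈ unitary (H →L[ℂ] H)) : IsPosDefInv (star u * x * u) := by
  simpa using hx.star_conj_add isPosDefInv_one (c := u) (d := 0)
    (by simpa using Unitary.star_mul_self_of_mem hu)

theorem IsPosDefInv.isCornerPosDef {p x : H →L[ℂ] H} (hp : IsStarProjection p)
    (hx : IsPosDefInv x) : IsCornerPosDef p (p * x * p) := by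
  have hi : p * p = p := hp.isIdempotentElem
  have hi' := mul_mul_cancel_left_of_eq hi
  refine ⟨hp.isSelfAdjoint.conjugate_nonneg hx.1, by simp only [mul_assoc, hi, hi'], ?_⟩
  obtain ⟨Y, hY⟩ := (isPosDefInv_blockDiag hp hx isPosDefInv_one).2
  have hc : Commute p (Y : H →L[ℂ] H) := hY ▸ commute_blockDiag hi x 1
  have hc' : Commute p (↑Y⁻¹ : H →L[ℂ] H) := hc.units_inv_right
  have hpY : p * x * p = Y * p := by
    rw [← blockDiag_compress hi x 1, ← hY, hc.eq, mul_assoc, hi]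
  refine ⟨p * ↑Y⁻¹ * p, by simp only [mul_assoc, hi, hi'], ?_, ?_⟩
  · rw [hpY, hc'.eq, mul_assoc (↑Y⁻¹ : H →L[ℂ] H), hi, mul_assoc, ← mul_assoc p, hc'.eq,
      mul_assoc, hi, ← mul_assoc, Y.mul_inv, one_mul]
  · rw [hpY, hc'.eq, mul_assoc (↑Y⁻¹ : H →L[ℂ] H), hi, mul_assoc, ← mul_assoc p, hc.eq, mul_assoc,
      hi, ← mul_assoc, Y.inv_mul, one_mul]

/-- A positive definite invertible operator stays so under small self-adjoint perturbations. -/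
theorem IsPosDefInv.exists_add {a : H →L[ℂ] H} (ha : IsPosDefInv a) :
    ∃ r : ℝ, 0 < r ∧ ∀ s : H →L[ℂ] H, IsSelfAdjoint s → ‖s‖ ≤ r → IsPosDefInv (a + s) := by
  obtain ⟨m, hm, ha⟩ := isPosDefInv_iff.1 ha
  refine ⟨m / 2, by positivity, fun s hs hsm ↦ isPosDefInv_iff.2 ⟨m / 2, by positivity, ?_⟩⟩
  have h1 := hs.neg_algebraMap_norm_le_self
  rw [Algebra.algebraMap_eq_smul_one] at h1
  have h2 : -((m / 2) • (1 : H →L[ℂ] H)) ≤ s :=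
    (neg_le_neg (smul_le_smul_of_nonneg_right hsm zero_le_one)).trans h1
  calc (m / 2) • (1 : H →L[ℂ] H) = m • 1 + -((m / 2) • 1) := by
        rw [← neg_smul, ← add_smul]; congr 1; ring
    _ ≤ _ := add_le_add ha h2

end Positivity

section Regular

variable {k : ℕ} {F : (Fin k → (H →L[ℂ] H)) → (H →L[ℂ] H)}

theorem IsRegularPD.map_blockDiag (hreg : IsRegularPD F) {p : H →L[ℂ] H}
    (hp : IsStarProjection p) {x w : Fin k → (H →L[ℂ] H)} (hx : ∀ i, IsPosDefInv (x i))
    (hw : ∀ i, IsPosDefInv (w i)) :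
    F (fun i ↦ blockDiag p (x i) (w i)) =
      blockDiag p (F fun i ↦ p * x i * p) (F fun i ↦ (1 - p) * w i * (1 - p)) :=
  hreg.2 p (1 - p) hp.isSelfAdjoint hp.isIdempotentElem hp.one_sub.isSelfAdjoint
    hp.one_sub.isIdempotentElem hp.isIdempotentElem.mul_one_sub_self x w
    (fun i ↦ (hx i).isCornerPosDef hp) (fun i ↦ (hw i).isCornerPosDef hp.one_sub)

theorem IsRegularPD.compress_map_blockDiag (hreg : IsRegularPD F) {p : H →L[ℂ] H}
    (hp : IsStarProjection p) {x w w' : Fin k → (H →L[ℂ] H)} (hx : ∀ i, IsPosDefInv (x i))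
    (hw : ∀ i, IsPosDefInv (w i)) (hw' : ∀ i, IsPosDefInv (w' i)) :
    p * F (fun i ↦ blockDiag p (x i) (w i)) * p =
      p * F (fun i ↦ blockDiag p (x i) (w' i)) * p := by
  rw [hreg.map_blockDiag hp hx hw, hreg.map_blockDiag hp hx hw',
    blockDiag_compress hp.isIdempotentElem, blockDiag_compress hp.isIdempotentElem]

theorem IsRegularPD.commute_map (hreg : IsRegularPD F) {p : H →L[ℂ] H}
    (hp : IsStarProjection p) {x : Fin k → (H →L[ℂ] H)} (hx : ∀ i, IsPosDefInv (x i))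
    (hc : ∀ i, Commute p (x i)) : Commute p (F x) := by
  have h : (fun i ↦ blockDiag p (x i) (x i)) = x :=
    funext fun i ↦ (hc i).blockDiag_self hp.isIdempotentElem
  rw [← h, hreg.map_blockDiag hp hx hx]
  exact commute_blockDiag hp.isIdempotentElem _ _

theorem IsRegularPD.map_conj_swapUnitary (hreg : IsRegularPD F) {p s : H →L[ℂ] H}
    (hs : IsOrthoPartialIsometry p s) {x : Fin k → (H →L[ℂ] H)} (hx : ∀ i, IsPosDefInv (x i)) :
    F (fun i ↦ swapUnitary p s * x i * swapUnitary p s) =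
      swapUnitary p s * F x * swapUnitary p s := by
  simpa only [hs.star_swapUnitary] using hreg.1 _ hs.swapUnitary_mem_unitary x hx

/-- Convexity of a mapping on tuples of positive definite invertible operators. -/
def IsConvexPD (F : (Fin k → (H →L[ℂ] H)) → (H →L[ℂ] H)) : Prop :=
  ∀ A B : Fin k → (H →L[ℂ] H), (∀ i, IsPosDefInv (A i)) → (∀ i, IsPosDefInv (B i)) →
    ∀ t : ℝ, 0 ≤ t → t ≤ 1 →
      F (fun i ↦ t • A i + (1 - t) • B i) ≤ t • F A + (1 - t) • F B

theorem IsRegularPD.compress_map_blockDiag_le (hreg : IsRegularPD F) (hconv : IsConvexPD F)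
    {p : H →L[ℂ] H} (hp : IsStarProjection p) {x w : Fin k → (H →L[ℂ] H)}
    (hx : ∀ i, IsPosDefInv (x i)) (hw : ∀ i, IsPosDefInv (w i)) :
    p * F (fun i ↦ blockDiag p (x i) (w i)) * p ≤ p * F x * p := by
  have hi : p * p = p := hp.isIdempotentElem
  have hi' := mul_mul_cancel_left_of_eq hi
  have hs : star p = p := hp.isSelfAdjoint
  rw [hreg.compress_map_blockDiag hp hx hw hx]
  set u : H →L[ℂ] H := p + p - 1 with hu_def
  have hsu : star u = u := by simp only [hu_def, star_sub, star_add, star_one, hs]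
  have huu : u * u = 1 := by
    simp only [hu_def, mul_add, add_mul, mul_sub, sub_mul, hi, mul_one, one_mul]
    abel
  have hpu : p * u = p := by
    simp only [hu_def, mul_add, mul_sub, hi, mul_one]
    abel
  have hup : u * p = p := by
    simp only [hu_def, add_mul, sub_mul, hi, one_mul]
    abel
  have hu : u ∈ unitary (H →L[ℂ] H) := by
    rw [Unitary.mem_iff, hsu]
    exact ⟨huu, huu⟩
  have key := hconv x (fun i ↦ star u * x i * u) hx (fun i ↦ (hx i).unitary_conj hu) (1 / 2)
    (by norm_num) (by norm_num)
  rw [hreg.1 u hu x hx, hsu] at key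
  have hmean : (fun i ↦ (1 / 2 : ℝ) • x i + (1 - 1 / 2 : ℝ) • (u * x i * u)) =
      fun i ↦ blockDiag p (x i) (x i) := by
    funext i
    have h2 : x i + u * x i * u = (2 : ℝ) • blockDiag p (x i) (x i) := by
      simp only [two_smul, hu_def, blockDiag, mul_add, add_mul, mul_sub, sub_mul, mul_assoc,
        one_mul, mul_one]
      abel
    rw [show (1 - 1 / 2 : ℝ) = 1 / 2 by norm_num, ← smul_add, h2, smul_smul]
    norm_num
  rw [hmean] at key
  have hconj := hp.isSelfAdjoint.conjugate_le_conjugate key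
  refine hconj.trans_eq ?_
  have h3 : p * (u * F x * u) * p = p * F x * p := by
    calc _ = (p * u) * F x * (u * p) := by simp only [mul_assoc]
      _ = _ := by rw [hpu, hup]
  rw [mul_add, add_mul, mul_smul_comm, mul_smul_comm, smul_mul_assoc, smul_mul_assoc, h3,
    ← add_smul]
  norm_num

/-- Jensen's inequality for compressions by a partial isometry whose final projection is
orthogonal to the initial one. -/
theorem IsRegularPD.compress_map_le_of_isOrthoPartialIsometry (hreg : IsRegularPD F)
    (hconv : IsConvexPD F) {p s : H →L[ℂ] H} (hs : IsOrthoPartialIsometry p s)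
    {x w X : Fin k → (H →L[ℂ] H)} (hw : ∀ i, IsPosDefInv (w i)) (hX : ∀ i, IsPosDefInv (X i))
    (h : ∀ i, star s * X i * s = p * x i * p) :
    p * F (fun i ↦ blockDiag p (x i) (w i)) * p ≤ star s * F X * s := by
  have hp : IsStarProjection p := ⟨hs.initial_mul_self, hs.star_initial⟩
  have hY : ∀ i, IsPosDefInv (swapUnitary p s * X i * swapUnitary p s) := fun i ↦ by
    simpa only [hs.star_swapUnitary] using (hX i).unitary_conj hs.swapUnitary_mem_unitary
  have h1 := hreg.compress_map_blockDiag_le hconv hp hY hw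
  rw [hreg.map_conj_swapUnitary hs hX, hs.compress_swapUnitary_conj] at h1
  convert h1 using 5 with i
  exact blockDiag_congr_left (by rw [hs.compress_swapUnitary_conj, h]) _

/-- A block of `F X` at the final projection of a partial isometry is dominated by the
corresponding compression of `F`. -/
theorem IsRegularPD.star_conj_map_le_of_commute (hreg : IsRegularPD F)
    (hconv : IsConvexPD F) {p s : H →L[ℂ] H} (hs : IsOrthoPartialIsometry p s)
    {x X : Fin k → (H →L[ℂ] H)} (hx : ∀ i, IsPosDefInv (x i)) (hX : ∀ i, IsPosDefInv (X i))
    (hc : ∀ i, Commute (s * star s) (X i)) (h : ∀ i, star s * X i * s = p * x i * p) :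
    star s * F X * s ≤ p * F x * p := by
  have hp : IsStarProjection p := ⟨hs.initial_mul_self, hs.star_initial⟩
  set Y : Fin k → (H →L[ℂ] H) := fun i ↦ swapUnitary p s * X i * swapUnitary p s
  have hY : ∀ i, IsPosDefInv (Y i) := fun i ↦ by
    simpa only [hs.star_swapUnitary] using (hX i).unitary_conj hs.swapUnitary_mem_unitary
  have hYp : ∀ i, Y i * p = p * x i * p := fun i ↦ by
    calc Y i * p = swapUnitary p s * X i * (swapUnitary p s * p) := mul_assoc _ _ _
      _ = swapUnitary p s * (X i * (s * star s)) * s := by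
        rw [hs.swapUnitary_mul_initial, mul_assoc, mul_assoc, mul_assoc (X i), mul_assoc s,
          hs.star_mul_self, hs.mul_initial]
      _ = (swapUnitary p s * s) * (star s * X i * s) := by
        rw [← (hc i).eq]; simp only [mul_assoc]
      _ = _ := by
        rw [hs.swapUnitary_mul, h]
        simp only [← mul_assoc, hs.initial_mul_self]
  have hYc : ∀ i, Commute p (Y i) := fun i ↦ by
    have := congrArg star (hYp i)
    simp only [star_mul, hs.star_initial, (hY i).isSelfAdjoint.star_eq,
      (hx i).isSelfAdjoint.star_eq] at this
    exact this.trans ((mul_assoc _ _ _).symm.trans (hYp i).symm)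
  have hYeq : (fun i ↦ blockDiag p (x i) (Y i)) = Y := funext fun i ↦ by
    rw [← blockDiag_congr_left (x := Y i), (hYc i).blockDiag_self hs.initial_mul_self]
    rw [mul_assoc, hYp]
    simp only [← mul_assoc, hs.initial_mul_self]
  have h1 := hreg.compress_map_blockDiag_le hconv hp hx hY
  rwa [hYeq, hreg.map_conj_swapUnitary hs hX, hs.compress_swapUnitary_conj] at h1

end Regular

section Dilation

variable {k : ℕ} {F : (Fin k → (H →L[ℂ] H)) → (H →L[ℂ] H)}

theorem isPosDefInv_sum_conj_add_compl {x y s t : H →L[ℂ] H} (hx : IsPosDefInv x)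
    (hy : IsPosDefInv y) (hst : 0 ≤ 1 - s * star s - t * star t) :
    IsPosDefInv (s * x * star s + t * y * star t + (1 - s * star s - t * star t)) := by
  obtain ⟨m, hm, hx⟩ := isPosDefInv_iff.1 hx
  obtain ⟨n, hn, hy⟩ := isPosDefInv_iff.1 hy
  refine isPosDefInv_iff.2 ⟨min (min m n) 1, lt_min (lt_min hm hn) one_pos, ?_⟩
  set r := min (min m n) 1
  have h1 : r • (1 : H →L[ℂ] H) ≤ x := (smul_le_smul_of_nonneg_right
    ((min_le_left _ _).trans (min_le_left m n)) zero_le_one).trans hx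
  have h2 : r • (1 : H →L[ℂ] H) ≤ y := (smul_le_smul_of_nonneg_right
    ((min_le_left _ _).trans (min_le_right m n)) zero_le_one).trans hy
  have h3 : r • (1 - s * star s - t * star t) ≤ 1 - s * star s - t * star t :=
    (smul_le_smul_of_nonneg_right (min_le_right _ _) hst).trans_eq (one_smul ℝ _)
  calc r • (1 : H →L[ℂ] H)
      = s * (r • 1) * star s + t * (r • 1) * star t + r • (1 - s * star s - t * star t) := by
        simp only [mul_smul_comm, smul_mul_assoc, mul_one, ← smul_add]
        congr 1
        abel
    _ ≤ _ := add_le_add (add_le_add (star_right_conjugate_le_conjugate h1 s)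
        (star_right_conjugate_le_conjugate h2 t)) h3

/-- Jensen's inequality for compressions to a projection `p`, provided that the space has room
for two further copies of a projection `q ≥ p` through which the coefficients factor. -/
theorem IsRegularPD.compress_map_star_conj_add_le (hreg : IsRegularPD F) (hconv : IsConvexPD F)
    {p q s t c d : H →L[ℂ] H} (hp : IsStarProjection p) (hs : IsOrthoPartialIsometry q s)
    (ht : IsOrthoPartialIsometry q t) (hst : star s * t = 0) (hqp : q * p = p)
    (hc : q * (c * p) = c * p) (hd : q * (d * p) = d * p) (hcd : star c * c + star d * d = 1)
    {x y w : Fin k → (H →L[ℂ] H)} (hx : ∀ i, IsPosDefInv (x i)) (hy : ∀ i, IsPosDefInv (y i))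
    (hw : ∀ i, IsPosDefInv (w i)) :
    p * F (fun i ↦ blockDiag p (star c * x i * c + star d * y i * d) (w i)) * p ≤
      p * (star c * F x * c + star d * F y * d) * p := by
  have hps : star p = p := hp.isSelfAdjoint
  have hpi : p * p = p := hp.isIdempotentElem
  have hts : star t * s = 0 := by simpa using congrArg star hst
  have hpq : p * q = p := by simpa [hps, hs.star_initial] using congrArg star hqp
  have hc' : p * (star c * q) = p * star c := by
    simpa [hps, hs.star_initial, mul_assoc] using congrArg star hc
  have hd' : p * (star d * q) = p * star d := by
    simpa [hps, hs.star_initial, mul_assoc] using congrArg star hd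
  have hc1 : ∀ z, p * (star c * (q * z)) = p * (star c * z) := fun z ↦ by
    simpa only [mul_assoc] using congrArg (· * z) hc'
  have hd1 : ∀ z, p * (star d * (q * z)) = p * (star d * z) := fun z ↦ by
    simpa only [mul_assoc] using congrArg (· * z) hd'
  set V := s * (c * p) + t * (d * p) with hV_def
  have hVs : star V = p * (star c * star s) + p * (star d * star t) := by
    simp only [hV_def, star_add, star_mul, hps, mul_assoc]
  have hss := hs.star_mul_self
  have htt := ht.star_mul_self
  have hV : IsOrthoPartialIsometry p V := by
    refine ⟨?_, ?_, ?_⟩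
    · calc star V * V = p * (star c * c + star d * d) * p := by
            rw [hVs, hV_def]
            simp only [mul_add, add_mul, mul_assoc, mul_mul_cancel_left_of_eq hss,
              mul_mul_cancel_left_of_eq htt, mul_mul_cancel_left_of_eq hst,
              mul_mul_cancel_left_of_eq hts, zero_mul, mul_zero, hc, hd]
            abel
        _ = p := by rw [hcd, mul_one, hpi]
    · simp only [hV_def, add_mul, mul_assoc, hpi]
    · rw [← hpq, hV_def, mul_assoc, mul_add, mul_mul_cancel_left_of_eq hs.initial_mul,
        mul_mul_cancel_left_of_eq ht.initial_mul, zero_mul, zero_mul, add_zero, mul_zero]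
  set X : Fin k → (H →L[ℂ] H) := fun i ↦
    s * x i * star s + t * y i * star t + (1 - s * star s - t * star t) with hX_def
  have hproj : IsStarProjection (1 - s * star s - t * star t) := by
    refine ⟨?_, ?_⟩
    · simp only [IsIdempotentElem, mul_sub, sub_mul, mul_assoc, one_mul, mul_one,
        mul_mul_cancel_left_of_eq hss, mul_mul_cancel_left_of_eq htt,
        mul_mul_cancel_left_of_eq hst, mul_mul_cancel_left_of_eq hts, zero_mul, mul_zero,
        hs.initial_mul_star, ht.initial_mul_star]
      abel
    · simp only [IsSelfAdjoint, star_sub, star_one, star_mul, star_star]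
  have hX : ∀ i, IsPosDefInv (X i) := fun i ↦
    isPosDefInv_sum_conj_add_compl (hx i) (hy i) hproj.nonneg
  have hcs : ∀ i, Commute (s * star s) (X i) := fun i ↦ by
    simp only [Commute, SemiconjBy, hX_def, mul_add, add_mul, mul_sub, sub_mul, mul_assoc,
      one_mul, mul_one, mul_mul_cancel_left_of_eq hss, mul_mul_cancel_left_of_eq hst,
      mul_mul_cancel_left_of_eq hts, zero_mul, mul_zero, hs.initial_mul_star,
      mul_mul_cancel_left_of_eq hs.mul_initial]
  have hct : ∀ i, Commute (t * star t) (X i) := fun i ↦ by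
    simp only [Commute, SemiconjBy, hX_def, mul_add, add_mul, mul_sub, sub_mul, mul_assoc,
      one_mul, mul_one, mul_mul_cancel_left_of_eq htt, mul_mul_cancel_left_of_eq hst,
      mul_mul_cancel_left_of_eq hts, zero_mul, mul_zero, ht.initial_mul_star,
      mul_mul_cancel_left_of_eq ht.mul_initial]
  have hsX : ∀ i, star s * X i * s = q * x i * q := fun i ↦ by
    simp only [hX_def, mul_add, add_mul, mul_sub, sub_mul, mul_assoc,
      mul_one, hss, mul_mul_cancel_left_of_eq hss, mul_mul_cancel_left_of_eq hst,
      zero_mul, hs.initial_mul_self]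
    abel
  have htX : ∀ i, star t * X i * t = q * y i * q := fun i ↦ by
    simp only [hX_def, mul_add, add_mul, mul_sub, sub_mul, mul_assoc,
      mul_one, htt, mul_mul_cancel_left_of_eq htt, mul_mul_cancel_left_of_eq hts,
      zero_mul, ht.initial_mul_self]
    abel
  have hVX : ∀ i, star V * X i * V = p * (star c * x i * c + star d * y i * d) * p := fun i ↦ by
    rw [hVs, hV_def]
    simp only [hX_def, mul_add, add_mul, mul_sub, sub_mul, mul_assoc,
      mul_one, mul_mul_cancel_left_of_eq hss, mul_mul_cancel_left_of_eq htt,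
      mul_mul_cancel_left_of_eq hst, mul_mul_cancel_left_of_eq hts, zero_mul, mul_zero,
      hc1, hd1, hc, hd]
    abel
  refine (hreg.compress_map_le_of_isOrthoPartialIsometry hconv hV hw hX hVX).trans ?_
  have hpss : IsStarProjection (s * star s) := by
    refine ⟨?_, ?_⟩
    · rw [IsIdempotentElem, mul_assoc, ← mul_assoc (star s), hss, hs.initial_mul_star]
    · simp only [IsSelfAdjoint, star_mul, star_star]
  have hcF := (hreg.commute_map hpss hX hcs).eq
  have hcross : star s * (F X * t) = 0 := by
    calc star s * (F X * t) = star s * ((s * star s) * F X) * t := by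
          simp only [mul_assoc, mul_mul_cancel_left_of_eq hss,
            mul_mul_cancel_left_of_eq hs.initial_mul_star]
      _ = 0 := by
          rw [hcF]
          simp only [mul_assoc, hst, mul_zero]
  have hcross' : star t * (F X * s) = 0 := by
    calc star t * (F X * s) = star t * (F X * (s * star s)) * s := by
          simp only [mul_assoc, hss, hs.mul_initial]
      _ = 0 := by
          rw [← hcF]
          simp only [mul_assoc, mul_mul_cancel_left_of_eq hts, zero_mul]
  have hcr : ∀ z, star s * (F X * (t * z)) = 0 := fun z ↦ by
    simpa only [mul_assoc, zero_mul] using congrArg (· * z) hcross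
  have hcr' : ∀ z, star t * (F X * (s * z)) = 0 := fun z ↦ by
    simpa only [mul_assoc, zero_mul] using congrArg (· * z) hcross'
  have hbs := star_left_conjugate_le_conjugate
    (hreg.star_conj_map_le_of_commute hconv hs hx hX hcs hsX) (c * p)
  have hbt := star_left_conjugate_le_conjugate
    (hreg.star_conj_map_le_of_commute hconv ht hy hX hct htX) (d * p)
  refine (add_le_add hbs hbt).trans' (le_of_eq ?_) |>.trans_eq ?_
  · rw [hVs, hV_def]
    simp only [mul_add, add_mul, star_mul, hps, mul_assoc, hcr, hcr', mul_zero]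
    abel
  · simp only [mul_add, add_mul, star_mul, hps, mul_assoc, hc, hd, hc1, hd1]

theorem exists_isOrthoPartialIsometry (hH : ¬ FiniteDimensional ℂ H) (E K : Submodule ℂ H)
    [FiniteDimensional ℂ E] [FiniteDimensional ℂ K] (hEK : E ≤ K) :
    ∃ s : H →L[ℂ] H, IsOrthoPartialIsometry E.starProjection s ∧ K.starProjection * s = 0 := by
  obtain ⟨w, b, hb⟩ := exists_hilbertBasis ℂ Kᗮ
  have hw : Infinite w := by
    by_contra hfin
    rw [not_infinite_iff_finite] at hfin
    have := Fintype.ofFinite w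
    have : FiniteDimensional ℂ Kᗮ := b.toOrthonormalBasis.toBasis.finiteDimensional_of_finite
    have : FiniteDimensional ℂ (K ⊔ Kᗮ : Submodule ℂ H) := inferInstance
    rw [Submodule.sup_orthogonal_of_hasOrthogonalProjection] at this
    exact hH (Module.Finite.equiv (Submodule.topEquiv (R := ℂ) (M := H)))
  let e := stdOrthonormalBasis ℂ E
  let g : Fin (Module.finrank ℂ E) ↪ w := (Fin.valEmbedding).trans (Infinite.natEmbedding w)
  have hf : Orthonormal ℂ (fun i ↦ (b (g i) : Kᗮ)) := b.orthonormal.comp g g.injective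
  let T : E →ₗᵢ[ℂ] H := Kᗮ.subtypeₗᵢ.comp
    ((e.toBasis.constr ℂ fun i ↦ b (g i)).isometryOfOrthonormal (v := e.toBasis)
      (by simp [e.orthonormal]) (by simpa [Function.comp_def] using hf))
  let s : H →L[ℂ] H := T.toContinuousLinearMap ∘L E.orthogonalProjectionOnto
  have hs : ∀ v, s v = T (E.orthogonalProjectionOnto v) := fun v ↦ rfl
  have hTK : ∀ v, T v ∈ Kᗮ := fun v ↦ Subtype.coe_prop _
  have hKs : K.starProjection * s = 0 := by
    ext v
    exact K.starProjection_apply_eq_zero_iff.2 (hTK _)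
  refine ⟨s, ⟨?_, ?_, ?_⟩, hKs⟩
  · ext v
    refine ext_inner_left ℂ fun u ↦ ?_
    rw [mul_apply_eq_comp, ContinuousLinearMap.star_eq_adjoint,
      ContinuousLinearMap.adjoint_inner_right, hs, hs, T.inner_map_map, Submodule.coe_inner]
    change inner ℂ (E.starProjection u) (E.starProjection v) = _
    rw [Submodule.inner_starProjection_left_eq_right, Submodule.starProjection_eq_self_iff.2
      (E.starProjection_apply_mem v)]
  · ext v
    rw [mul_apply_eq_comp, hs, hs]
    congr 1
    ext1
    exact Submodule.starProjection_eq_self_iff.2 (E.starProjection_apply_mem v)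
  · ext v
    exact E.starProjection_apply_eq_zero_iff.2 (Submodule.orthogonal_le hEK (hTK _))

theorem IsRegularPD.compress_map_le (hH : ¬ FiniteDimensional ℂ H) (hreg : IsRegularPD F)
    (hconv : IsConvexPD F) (E K : Submodule ℂ H) [FiniteDimensional ℂ E] [FiniteDimensional ℂ K]
    (hEK : E ≤ K) {c d : H →L[ℂ] H} (hc : ∀ v ∈ E, c v ∈ K) (hd : ∀ v ∈ E, d v ∈ K)
    (hcd : star c * c + star d * d = 1)
    {x y w : Fin k → (H →L[ℂ] H)} (hx : ∀ i, IsPosDefInv (x i)) (hy : ∀ i, IsPosDefInv (y i))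
    (hw : ∀ i, IsPosDefInv (w i)) :
    E.starProjection * F (fun i ↦ blockDiag E.starProjection
        (star c * x i * c + star d * y i * d) (w i)) * E.starProjection ≤
      E.starProjection * (star c * F x * c + star d * F y * d) * E.starProjection := by
  obtain ⟨s, hs, -⟩ := exists_isOrthoPartialIsometry hH K K le_rfl
  let R : Submodule ℂ H := K.map (s : H →ₗ[ℂ] H)
  obtain ⟨t, ht, hRt⟩ := exists_isOrthoPartialIsometry hH K (K ⊔ R) le_sup_left
  have hRs : (K ⊔ R).starProjection * s = s := by
    ext v
    refine Submodule.starProjection_eq_self_iff.2 (Submodule.mem_sup_right ?_)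
    rw [← hs.mul_initial]
    exact Submodule.mem_map_of_mem (K.starProjection_apply_mem v)
  have hst : star s * t = 0 := by
    rw [← hRs, star_mul, isStarProjection_starProjection.isSelfAdjoint.star_eq, mul_assoc, hRt,
      mul_zero]
  have hmul : ∀ g : H →L[ℂ] H, (∀ v ∈ E, g v ∈ K) →
      K.starProjection * (g * E.starProjection) = g * E.starProjection := fun g hg ↦ by
    ext v
    exact Submodule.starProjection_eq_self_iff.2 (hg _ (E.starProjection_apply_mem v))
  exact hreg.compress_map_star_conj_add_le hconv isStarProjection_starProjection hs ht hst
    (by simpa using hmul 1 hEK) (hmul c hc) (hmul d hd) hcd hx hy hw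

end Dilation

section OffDiag

variable {A : Type*} [Ring A]

/-- The part of `x` which is off-diagonal with respect to `p` and `1 - p`. -/
def offDiag (p x : A) : A := p * x * (1 - p) + (1 - p) * x * p

theorem offDiag_add_blockDiag (p x : A) : offDiag p x + blockDiag p x x = x := by
  simp only [offDiag, blockDiag, mul_sub, sub_mul, mul_one, one_mul]
  abel

theorem offDiag_add (p x y : A) : offDiag p (x + y) = offDiag p x + offDiag p y := by
  simp only [offDiag, mul_add, add_mul]
  abel

theorem offDiag_smul [Algebra ℝ A] (p : A) (r : ℝ) (x : A) :
    offDiag p (r • x) = r • offDiag p x := by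
  simp only [offDiag, mul_smul_comm, smul_mul_assoc, smul_add]

theorem mul_corner_mul_one_sub_of_absorb {e f h z P : A} (he : e * e = e) (hfe : f * e = f)
    (hPe : Commute P e) (hPh : Commute P h)
    (hfz : f * z * e = f * z) (hez : e * z * h = e * z) (hP : P * (e - f) = e - f)
    (hP' : P * (h - e) = 0) :
    e * (P * z * (1 - P) + (1 - P) * z * P) * (1 - e) = e * z * (1 - e) := by
  have hPe' : P * e = e - f + P * f := by rw [← hP, mul_sub, sub_add_cancel]
  have hPh' : h * P = e - f + P * f := by
    rw [← hPh.eq, ← hPe', ← sub_eq_zero, ← mul_sub, hP']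
  have heP : ∀ x, e * (P * x) = e * x - f * x + P * (f * x) := fun x ↦ by
    rw [← mul_assoc, ← hPe.eq, hPe', add_mul, sub_mul, mul_assoc]
  have hzP : e * (z * P) = e * (z * e) - e * (z * f) + e * (z * (P * f)) := by
    rw [← mul_assoc, ← hez, mul_assoc, hPh', mul_add, mul_sub]
    simp only [mul_assoc]
  have hfP : f * (z * P) = f * (z * e) - f * (z * f) + f * (z * (P * f)) := by
    rw [← mul_assoc, ← hfz, mul_assoc, ← hPe.eq, hPe', mul_add, mul_sub]
    simp only [mul_assoc]
  rw [mul_assoc] at hfz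
  simp only [mul_add, add_mul, mul_sub, sub_mul, mul_one, one_mul, mul_assoc, heP, hzP, hfP,
    hfz, he, hfe]
  abel

/-- If `P` contains one of the consecutive differences of `f ≤ e ≤ h` and is orthogonal to the
other one, then the part of `z` which exchanges `P` and its complement has the same off-diagonal
part at `e` as `z`. -/
theorem mul_corner_mul_one_sub {e f h z P : A} (he : e * e = e) (hfe : f * e = f)
    (hPe : Commute P e) (hPh : Commute P h)
    (hfz : f * z * e = f * z) (hez : e * z * h = e * z)
    (hP : (P * (e - f) = e - f ∧ P * (h - e) = 0) ∨ (P * (e - f) = 0 ∧ P * (h - e) = h - e)) :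
    e * (P * z * (1 - P) + (1 - P) * z * P) * (1 - e) = e * z * (1 - e) := by
  rcases hP with ⟨h1, h2⟩ | ⟨h1, h2⟩
  · exact mul_corner_mul_one_sub_of_absorb he hfe hPe hPh hfz hez h1 h2
  · have := mul_corner_mul_one_sub_of_absorb (P := 1 - P) he hfe
      ((Commute.one_left e).sub_left hPe) ((Commute.one_left h).sub_left hPh) hfz hez
      (by rw [sub_mul, h1, one_mul, sub_zero]) (by rw [sub_mul, h2, one_mul, sub_self])
    rwa [sub_sub_cancel, add_comm] at this

theorem mul_corner_mul_eq_zero {g z P : A} (hPg : Commute P g) (hP : P * g = g ∨ P * g = 0) :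
    g * (P * z * (1 - P) + (1 - P) * z * P) * g = 0 := by
  have h1 : (1 - P) * g = 0 ∨ P * g = 0 := hP.imp_left fun h ↦ by rw [sub_mul, one_mul, h, sub_self]
  have h2 : Commute (1 - P) g := (Commute.one_left g).sub_left hPg
  rw [mul_add, add_mul, mul_assoc P, ← mul_assoc g P, ← hPg.eq, mul_assoc (1 - P) z,
    ← mul_assoc g (1 - P), ← h2.eq]
  simp only [mul_assoc]
  rcases h1 with h1 | h1 <;> simp [h1, mul_mul_cancel_left_of_eq h1]

end OffDiag

section Filtration

omit [CompleteSpace H] in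
theorem exists_filtration {ι : Type*} [Finite ι] (T : ι → (H →L[ℂ] H)) (ξ : H) :
    ∃ E : ℕ → Submodule ℂ H, (∀ n, FiniteDimensional ℂ (E n)) ∧ Monotone E ∧ (∀ n, ξ ∈ E n) ∧
      ∀ n i, ∀ v ∈ E n, T i v ∈ E (n + 1) := by
  let E : ℕ → Submodule ℂ H := fun n ↦
    n.rec (Submodule.span ℂ {ξ}) fun _ K ↦ K ⊔ ⨆ i, K.map (T i : H →ₗ[ℂ] H)
  have hE : ∀ n, E (n + 1) = E n ⊔ ⨆ i, (E n).map (T i : H →ₗ[ℂ] H) := fun n ↦ rfl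
  have hmono : Monotone E := monotone_nat_of_le_succ fun n ↦ hE n ▸ le_sup_left
  refine ⟨E, fun n ↦ ?_, hmono, fun n ↦ hmono n.zero_le (Submodule.mem_span_singleton_self ξ),
    fun n i v hv ↦ hE n ▸ Submodule.mem_sup_right
      (Submodule.mem_iSup_of_mem i (Submodule.mem_map_of_mem hv))⟩
  induction n with
  | zero => exact inferInstanceAs (FiniteDimensional ℂ (Submodule.span ℂ {ξ}))
  | succ n ih =>
    have h : ∀ K : Submodule ℂ H, FiniteDimensional ℂ K →
        FiniteDimensional ℂ (K ⊔ ⨆ i, K.map (T i : H →ₗ[ℂ] H) : Submodule ℂ H) :=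
      fun K _ ↦ inferInstance
    exact h _ ih

omit [CompleteSpace H] in
theorem starProjection_mul_of_le {E K : Submodule ℂ H} [E.HasOrthogonalProjection]
    [K.HasOrthogonalProjection] (h : E ≤ K) :
    K.starProjection * E.starProjection = E.starProjection := by
  ext v
  exact Submodule.starProjection_eq_self_iff.2 (h (E.starProjection_apply_mem v))

theorem starProjection_mul_of_ge {E K : Submodule ℂ H} [E.HasOrthogonalProjection]
    [K.HasOrthogonalProjection] (h : E ≤ K) :
    E.starProjection * K.starProjection = E.starProjection := by
  simpa [isStarProjection_starProjection.isSelfAdjoint.star_eq] using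
    congrArg star (starProjection_mul_of_le h)

/-- For a sequence of mutually orthogonal projections there is a projection which dominates the
terms of even index and is orthogonal to the terms of odd index. -/
theorem exists_isStarProjection_alternating (g : ℕ → (H →L[ℂ] H)) (hg : ∀ n, IsSelfAdjoint (g n))
    (hortho : ∀ m n, m ≠ n → g m * g n = 0) :
    ∃ P : H →L[ℂ] H, IsStarProjection P ∧
      ∀ n, P * g (2 * n) = g (2 * n) ∧ P * g (2 * n + 1) = 0 := by
  let S : Submodule ℂ H := ⨅ n, (g (2 * n + 1) : H →L[ℂ] H).ker
  have hS : IsClosed (S : Set H) := by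
    rw [Submodule.coe_iInf]
    exact isClosed_iInter fun n ↦ (g (2 * n + 1)).isClosed_ker
  have : CompleteSpace S := hS.completeSpace_coe
  refine ⟨S.starProjection, isStarProjection_starProjection, fun n ↦ ⟨?_, ?_⟩⟩
  · ext v
    refine Submodule.starProjection_eq_self_iff.2 ((Submodule.mem_iInf _).2 fun m ↦ ?_)
    exact DFunLike.congr_fun (hortho (2 * m + 1) (2 * n) (by omega)) v
  · ext v
    refine S.starProjection_apply_eq_zero_iff.2 fun u hu ↦ ?_
    have hu : g (2 * n + 1) u = 0 := (Submodule.mem_iInf _).1 hu n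
    change inner ℂ u (g (2 * n + 1) v) = 0
    rw [← ContinuousLinearMap.adjoint_inner_left, ← ContinuousLinearMap.star_eq_adjoint,
      (hg _).star_eq, hu, inner_zero_left]

/-- Given a self-adjoint `z` which maps each subspace of a filtration into the next one, there
is a bounded self-adjoint operator with the same off-diagonal parts, whose compressions are the
sums of these parts. -/
theorem exists_offDiag_eq (E : ℕ → Submodule ℂ H) [∀ n, FiniteDimensional ℂ (E n)]
    (hE : Monotone E) {z : H →L[ℂ] H} (hz : IsSelfAdjoint z)
    (hzE : ∀ n, ∀ v ∈ E n, z v ∈ E (n + 1)) :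
    ∃ L : H →L[ℂ] H, IsSelfAdjoint L ∧
      (∀ n, (E n).starProjection * L * (1 - (E n).starProjection) =
        (E n).starProjection * z * (1 - (E n).starProjection)) ∧
      ∀ n, (E n).starProjection * L * (E n).starProjection =
        ∑ j ∈ Finset.range n, offDiag (E j).starProjection z := by
  set e : ℕ → (H →L[ℂ] H) := fun n ↦ (E n).starProjection
  have hes : ∀ n, IsSelfAdjoint (e n) := fun n ↦ isStarProjection_starProjection.isSelfAdjoint
  have hle : ∀ m n, m ≤ n → e n * e m = e m := fun m n h ↦ starProjection_mul_of_le (hE h)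
  have hge : ∀ m n, m ≤ n → e m * e n = e m := fun m n h ↦ starProjection_mul_of_ge (hE h)
  have hei : ∀ n, e n * e n = e n := fun n ↦ hle n n le_rfl
  have hze : ∀ n, e (n + 1) * (z * e n) = z * e n := fun n ↦ by
    ext v
    exact Submodule.starProjection_eq_self_iff.2 (hzE n _ ((E n).starProjection_apply_mem v))
  have hez : ∀ n, e n * z * e (n + 1) = e n * z := fun n ↦ by
    simpa [(hes _).star_eq, hz.star_eq] using congrArg star (hze n)
  let f : ℕ → (H →L[ℂ] H) := fun n ↦ n.casesOn 0 e
  have hf0 : f 0 = 0 := rfl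
  have hf : ∀ n, f (n + 1) = e n := fun n ↦ rfl
  have hfs : ∀ n, IsSelfAdjoint (f n) := fun n ↦ by
    cases n
    · exact .zero _
    · exact hes _
  have hffe : ∀ m n, m ≤ n + 1 → f m * e n = f m := fun m n h ↦ by
    cases m
    · exact zero_mul _
    · exact hge _ _ (by omega)
  have hff : ∀ m n, m ≤ n → f m * f n = f m := fun m n h ↦ by
    cases n
    · obtain rfl : m = 0 := by omega
      simp [hf0]
    · exact hffe _ _ h
  have hfz : ∀ n, f n * z * e n = f n * z := fun n ↦ by
    cases n
    · simp [hf0]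
    · exact hez _
  let g : ℕ → (H →L[ℂ] H) := fun n ↦ e n - f n
  have hgs : ∀ n, IsSelfAdjoint (g n) := fun n ↦ (hes n).sub (hfs n)
  have hlt : ∀ m n, m < n → g m * g n = 0 := fun m n h ↦ by
    simp only [g, mul_sub, sub_mul, hge m n h.le, hffe m n (by omega), hff m n h.le]
    rw [← hf m, hff _ _ h, sub_self]
  obtain ⟨P, hP, hPg⟩ := exists_isStarProjection_alternating g hgs fun m n hmn ↦ by
    rcases hmn.lt_or_gt with h | h
    · exact hlt m n h
    · simpa [(hgs _).star_eq] using congrArg star (hlt n m h)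
  have hPs : star P = P := hP.isSelfAdjoint
  have hPg' : ∀ n, P * g n = g n ∨ P * g n = 0 := fun n ↦ by
    rcases n.even_or_odd' with ⟨m, rfl | rfl⟩
    · exact .inl (hPg m).1
    · exact .inr (hPg m).2
  have hcg : ∀ n, Commute P (g n) := fun n ↦ by
    rcases hPg' n with h | h
    all_goals
      have h' := congrArg star h
      simp only [star_mul, hPs, (hgs n).star_eq, star_zero] at h'
      exact h.trans h'.symm
  have hcf : ∀ n, Commute P (f n) := fun n ↦ by
    induction n with
    | zero => exact Commute.zero_right P
    | succ n ih =>
      have := (hcg n).add_right ih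
      rwa [sub_add_cancel] at this
  have hce : ∀ n, Commute P (e n) := fun n ↦ hcf (n + 1)
  have hL : IsSelfAdjoint (P * z * (1 - P) + (1 - P) * z * P) := by
    simp only [IsSelfAdjoint, star_add, star_sub, star_one, star_mul, hPs, hz.star_eq]
    rw [add_comm]
    simp only [mul_assoc]
  have hoff : ∀ n, e n * (P * z * (1 - P) + (1 - P) * z * P) * (1 - e n) =
      e n * z * (1 - e n) := fun n ↦ by
    refine mul_corner_mul_one_sub (hei n) (hffe n n n.le_succ) (hce n) (hce (n + 1)) (hfz n)
      (hez n) ?_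
    rcases n.even_or_odd' with ⟨m, rfl | rfl⟩
    · exact .inl ⟨(hPg m).1, (hPg m).2⟩
    · exact .inr ⟨(hPg m).2, (hPg (m + 1)).1⟩
  have hdiag : ∀ n, g n * (P * z * (1 - P) + (1 - P) * z * P) * g n = 0 := fun n ↦
    mul_corner_mul_eq_zero (hcg n) (hPg' n)
  generalize P * z * (1 - P) + (1 - P) * z * P = L at hL hoff hdiag
  refine ⟨L, hL, hoff, fun n ↦ ?_⟩
  have hoff' : ∀ n, (1 - e n) * L * e n = (1 - e n) * z * e n := fun n ↦ by
    simpa [(hes n).star_eq, hL.star_eq, hz.star_eq, mul_assoc] using congrArg star (hoff n)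
  induction n with
  | zero =>
    have hg0 : g 0 = e 0 := sub_zero _
    simpa [hg0] using hdiag 0
  | succ n ih =>
    rw [Finset.sum_range_succ, ← ih]
    have h1 : e n * L * g (n + 1) = e n * z * (1 - e n) := by
      calc e n * L * g (n + 1) = e n * L * (1 - e n) * e (n + 1) := by
            rw [mul_assoc _ (1 - e n), sub_mul, one_mul, hge n (n + 1) n.le_succ]
        _ = e n * z * e (n + 1) - e n * z * (e n * e (n + 1)) := by
            rw [hoff]; simp only [mul_sub, sub_mul, mul_one, mul_assoc]
        _ = _ := by rw [hge n (n + 1) n.le_succ, hez, mul_sub, mul_one]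
    have h2 : g (n + 1) * L * e n = (1 - e n) * z * e n := by
      simpa [(hes n).star_eq, (hgs _).star_eq, hL.star_eq, hz.star_eq, mul_assoc] using
        congrArg star h1
    have h3 : e (n + 1) = e n + g (n + 1) := (add_sub_cancel _ _).symm
    calc e (n + 1) * L * e (n + 1)
        = e n * L * e n + (e n * L * g (n + 1) + g (n + 1) * L * e n)
          + g (n + 1) * L * g (n + 1) := by
          rw [h3]; simp only [mul_add, add_mul]; abel
      _ = _ := by rw [h1, h2, hdiag, add_zero]; rfl

end Filtration

section Jensen

variable {k : ℕ} {F : (Fin k → (H →L[ℂ] H)) → (H →L[ℂ] H)}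

theorem reApplyInnerSelf_le_of_compress_le {p S T : H →L[ℂ] H} (hp : IsSelfAdjoint p) {ξ : H}
    (hξ : p ξ = ξ) (h : p * S * p ≤ p * T * p) : S.reApplyInnerSelf ξ ≤ T.reApplyInnerSelf ξ := by
  have key : ∀ R : H →L[ℂ] H, (p * R * p).reApplyInnerSelf ξ = R.reApplyInnerSelf ξ := fun R ↦ by
    simp only [ContinuousLinearMap.reApplyInnerSelf_apply, mul_apply_eq_comp]
    conv_lhs => rw [← hp.star_eq, ContinuousLinearMap.star_eq_adjoint,
      ContinuousLinearMap.adjoint_inner_left, ← ContinuousLinearMap.star_eq_adjoint, hp.star_eq, hξ]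
  have := ((ContinuousLinearMap.le_def _ _).1 h).2 ξ
  rw [← key S, ← key T]
  simpa [ContinuousLinearMap.reApplyInnerSelf_apply, inner_sub_left] using this

theorem IsConvexPD.convexOn_reApplyInnerSelf (hconv : IsConvexPD F) (ξ : H) :
    ConvexOn ℝ {A : Fin k → (H →L[ℂ] H) | ∀ i, IsPosDefInv (A i)}
      fun A ↦ (F A).reApplyInnerSelf ξ := by
  refine ⟨convex_isPosDefInv k, fun A hA B hB a b ha hb hab ↦ ?_⟩
  have h := hconv A B hA hB a ha (by linarith)
  rw [← eq_sub_iff_add_eq'] at hab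
  rw [← hab] at h
  have := ((ContinuousLinearMap.le_def _ _).1 h).2 ξ
  simp [ContinuousLinearMap.reApplyInnerSelf_apply, inner_sub_left, inner_add_left,
    inner_smul_left_eq_smul] at this ⊢
  exact this

omit [CompleteSpace H] in
/-- If the off-diagonal parts of `z` along an increasing sequence of projections `e j` coincide
with those of `M`, and add up to `M`, then `z` is a mean of operators which commute with
the `e j`. -/
theorem sum_blockDiag_add_smul {n : ℕ} {e : ℕ → (H →L[ℂ] H)} {z M : H →L[ℂ] H} {δ : ℝ}
    (hδ : δ * (n + 1) = 1) (hM : ∀ j < n + 2, offDiag (e j) M = offDiag (e j) z)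
    (hsum : M = ∑ j ∈ Finset.range (n + 2), offDiag (e j) z) :
    ∑ j ∈ Finset.range (n + 2), ((n : ℝ) + 2)⁻¹ • blockDiag (e j) (z + δ • M) (z + δ • M) = z := by
  have h1 : ∀ j ∈ Finset.range (n + 2), blockDiag (e j) (z + δ • M) (z + δ • M) =
      (z + δ • M) - (1 + δ) • offDiag (e j) z := fun j hj ↦ by
    rw [eq_sub_of_add_eq' (offDiag_add_blockDiag (e j) (z + δ • M)), offDiag_add, offDiag_smul,
      hM j (Finset.mem_range.1 hj), add_smul, one_smul]
  rw [← Finset.smul_sum, Finset.sum_congr rfl h1, Finset.sum_sub_distrib, ← Finset.smul_sum,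
    ← hsum, Finset.sum_const, Finset.card_range, ← Nat.cast_smul_eq_nsmul ℝ,
    inv_smul_eq_iff₀ (by positivity)]
  have h2 : ((n + 2 : ℕ) : ℝ) * δ = 1 + δ := by push_cast; linarith
  rw [smul_add, smul_smul, h2]
  simp

theorem exists_pos_forall_isPosDefInv_add {z : Fin k → (H →L[ℂ] H)} (hz : ∀ i, IsPosDefInv (z i))
    (C : Fin k → ℝ) : ∃ δ : ℝ, 0 < δ ∧ ∀ i, ∀ s : H →L[ℂ] H, IsSelfAdjoint s → ‖s‖ ≤ C i →
      ∀ ε : ℝ, 0 ≤ ε → ε ≤ δ → IsPosDefInv (z i + ε • s) := by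
  choose r hr h using fun i ↦ (hz i).exists_add
  have h1 : ∀ i, ∀ᶠ δ in nhdsWithin (0 : ℝ) (Set.Ioi 0), δ * C i < r i := fun i ↦ by
    have : Filter.Tendsto (fun δ : ℝ ↦ δ * C i) (nhdsWithin 0 (Set.Ioi 0)) (nhds (0 * C i)) :=
      ((continuous_id.mul continuous_const).tendsto 0).mono_left nhdsWithin_le_nhds
    rw [zero_mul] at this
    exact this.eventually_lt_const (hr i)
  obtain ⟨δ, hδ, hδ0⟩ := ((Filter.eventually_all.2 h1).and self_mem_nhdsWithin).exists
  refine ⟨δ, hδ0, fun i s hs hsC ε hε hεδ ↦ h i _ ?_ ?_⟩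
  · simp only [IsSelfAdjoint, star_smul, hs.star_eq, star_trivial]
  · rw [norm_smul, Real.norm_of_nonneg hε]
    exact (mul_le_mul hεδ hsC (norm_nonneg s) (le_of_lt hδ0)).trans (hδ i).le

/-- If `F` is convex and regular, then the block diagonal truncations along a filtration through
which `z` moves one step at a time determine an upper bound for `F z`. -/
theorem IsRegularPD.reApplyInnerSelf_map_le (hreg : IsRegularPD F) (hconv : IsConvexPD F)
    (E : ℕ → Submodule ℂ H) [∀ n, FiniteDimensional ℂ (E n)] (hE : Monotone E)
    {z : Fin k → (H →L[ℂ] H)} (hz : ∀ i, IsPosDefInv (z i))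
    (hzE : ∀ i n, ∀ v ∈ E n, z i v ∈ E (n + 1)) {ξ : H} (hξE : ∀ n, ξ ∈ E n) {κ : ℝ}
    (hκ : ∀ j, ∀ w : Fin k → (H →L[ℂ] H), (∀ i, IsPosDefInv (w i)) →
      (F fun i ↦ blockDiag (E j).starProjection (z i) (w i)).reApplyInnerSelf ξ ≤ κ) :
    (F z).reApplyInnerSelf ξ ≤ κ := by
  choose L hL hoff hdiag using fun i ↦ exists_offDiag_eq E hE (hz i).isSelfAdjoint (hzE i)
  set e : ℕ → (H →L[ℂ] H) := fun n ↦ (E n).starProjection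
  have hep : ∀ n, IsStarProjection (e n) := fun n ↦ isStarProjection_starProjection
  have hle : ∀ m n, m ≤ n → e n * e m = e m := fun m n h ↦ starProjection_mul_of_le (hE h)
  have hge : ∀ m n, m ≤ n → e m * e n = e m := fun m n h ↦ starProjection_mul_of_ge (hE h)
  have heξ : ∀ n, e n ξ = ξ := fun n ↦ Submodule.starProjection_eq_self_iff.2 (hξE n)
  have hez : ∀ i n, e n * z i * e (n + 1) = e n * z i := fun i n ↦ by
    have : e (n + 1) * (z i * e n) = z i * e n := by
      ext v
      exact Submodule.starProjection_eq_self_iff.2 (hzE i n _ ((E n).starProjection_apply_mem v))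
    simpa [(hep _).isSelfAdjoint.star_eq, (hz i).isSelfAdjoint.star_eq] using congrArg star this
  obtain ⟨δ₀, hδ₀, hpos⟩ := exists_pos_forall_isPosDefInv_add hz fun i ↦ ‖L i‖
  set b := (F fun i ↦ z i + δ₀ • L i).reApplyInnerSelf ξ
  have hbound : ∀ n : ℕ, 1 / ((n : ℝ) + 1) ≤ δ₀ → (F z).reApplyInnerSelf ξ ≤
      (1 - 1 / ((n : ℝ) + 1) / δ₀) * κ + 1 / ((n : ℝ) + 1) / δ₀ * b := fun n hn ↦ by
    set δ : ℝ := 1 / ((n : ℝ) + 1) with hδ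
    have hδ0 : 0 ≤ δ := by positivity
    set θ := δ / δ₀
    have hθ0 : 0 ≤ θ := by positivity
    have hθ1 : θ ≤ 1 := (div_le_one hδ₀).2 hn
    have hθδ : θ * δ₀ = δ := div_mul_cancel₀ _ hδ₀.ne'
    set M : Fin k → (H →L[ℂ] H) := fun i ↦ e (n + 2) * L i * e (n + 2) with hM
    have hMs : ∀ i, IsSelfAdjoint (M i) := fun i ↦ by
      simp only [hM, IsSelfAdjoint, star_mul, (hep _).isSelfAdjoint.star_eq, (hL i).star_eq,
        mul_assoc]
    have hMn : ∀ i, ‖M i‖ ≤ ‖L i‖ := fun i ↦ by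
      have h1 : ‖e (n + 2)‖ ≤ 1 := (E (n + 2)).starProjection_norm_le
      calc ‖M i‖ ≤ ‖e (n + 2)‖ * ‖L i‖ * ‖e (n + 2)‖ := by
            refine (norm_mul_le _ _).trans ?_
            gcongr
            exact norm_mul_le _ _
        _ ≤ 1 * ‖L i‖ * 1 := by gcongr
        _ = ‖L i‖ := by ring
    have hMdiag : ∀ i, ∀ j < n + 2, e j * M i * e j = e j * L i * e j := fun i j hj ↦ by
      simp only [hM, mul_assoc, hle j (n + 2) hj.le, mul_mul_cancel_left_of_eq (hge j _ hj.le)]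
    have hMoff : ∀ i, ∀ j < n + 2, offDiag (e j) (M i) = offDiag (e j) (z i) := fun i j hj ↦ by
      have h1 : e j * M i * (1 - e j) = e j * z i * (1 - e j) := by
        calc e j * M i * (1 - e j) = e j * L i * (1 - e j) * e (n + 2) := by
              simp only [hM, mul_assoc, mul_sub, sub_mul, mul_one, hle j (n + 2) hj.le,
                hge j (n + 2) hj.le, mul_mul_cancel_left_of_eq (hge j _ hj.le)]
          _ = e j * z i * (e (j + 1) * e (n + 2)) - e j * z i * e j := by
              rw [hoff, ← mul_assoc, hez, mul_assoc, sub_mul, one_mul, hge j (n + 2) hj.le, mul_sub]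
          _ = _ := by rw [hge (j + 1) (n + 2) hj, hez, mul_sub, mul_one]
      have h2 : (1 - e j) * M i * e j = (1 - e j) * z i * e j := by
        simpa [(hep _).isSelfAdjoint.star_eq, (hMs i).star_eq, (hz i).isSelfAdjoint.star_eq,
          mul_assoc] using congrArg star h1
      rw [offDiag, offDiag, h1, h2]
    set w : Fin k → (H →L[ℂ] H) := fun i ↦ z i + δ • M i
    have hw : ∀ i, IsPosDefInv (w i) := fun i ↦ hpos i _ (hMs i) (hMn i) δ hδ0 hn
    have hv : ∀ i, IsPosDefInv (z i + δ₀ • L i) := fun i ↦ hpos i _ (hL i) le_rfl δ₀ hδ₀.le le_rfl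
    have hφ := hconv.convexOn_reApplyInnerSelf ξ
    have hmean : ∑ j ∈ Finset.range (n + 2), ((n : ℝ) + 2)⁻¹ •
        (fun i ↦ blockDiag (e j) (w i) (w i)) = z := by
      ext1 i
      simp only [Finset.sum_apply, Pi.smul_apply]
      exact sum_blockDiag_add_smul (by rw [hδ]; field_simp) (hMoff i) (hdiag i (n + 2))
    have hj : ∀ j ∈ Finset.range (n + 2),
        (F fun i ↦ blockDiag (e j) (w i) (w i)).reApplyInnerSelf ξ ≤ (1 - θ) * κ + θ * b := by
      intro j hj
      have hj := Finset.mem_range.1 hj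
      have hsplit : (fun i ↦ blockDiag (e j) (w i) (w i)) =
          (1 - θ) • (fun i ↦ blockDiag (e j) (z i) (w i)) +
            θ • (fun i ↦ blockDiag (e j) (z i + δ₀ • L i) (w i)) := by
        ext1 i
        have h1 : e j * w i * e j = (1 - θ) • (e j * z i * e j) +
            θ • (e j * (z i + δ₀ • L i) * e j) := by
          simp only [w, mul_add, add_mul, mul_smul_comm, smul_mul_assoc, hMdiag i j hj, smul_add,
            smul_smul, hθδ, sub_smul, one_smul]
          abel
        simp only [Pi.add_apply, Pi.smul_apply, blockDiag, h1, smul_add]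
        rw [add_add_add_comm, ← add_smul, sub_add_cancel, one_smul]
      rw [hsplit]
      refine (hφ.2 (fun i ↦ isPosDefInv_blockDiag (hep j) (hz i) (hw i))
        (fun i ↦ isPosDefInv_blockDiag (hep j) (hv i) (hw i)) (sub_nonneg.2 hθ1) hθ0
        (sub_add_cancel _ _)).trans ?_
      rw [smul_eq_mul, smul_eq_mul]
      refine add_le_add (mul_le_mul_of_nonneg_left ?_ (sub_nonneg.2 hθ1))
        (mul_le_mul_of_nonneg_left ?_ hθ0)
      · exact hκ j w hw
      · exact reApplyInnerSelf_le_of_compress_le (hep j).isSelfAdjoint (heξ j)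
          (hreg.compress_map_blockDiag_le hconv (hep j) hv hw)
    have hcard : ∑ j ∈ Finset.range (n + 2), ((n : ℝ) + 2)⁻¹ = 1 := by
      simp [mul_inv_cancel₀ (show (n : ℝ) + 2 ≠ 0 by positivity)]
    have hJ := hφ.map_sum_le (t := Finset.range (n + 2)) (w := fun _ ↦ ((n : ℝ) + 2)⁻¹)
      (p := fun j i ↦ blockDiag (e j) (w i) (w i)) (fun _ _ ↦ by positivity) hcard
      (fun j _ i ↦ isPosDefInv_blockDiag (hep j) (hw i) (hw i))
    rw [hmean] at hJ
    refine hJ.trans ((Finset.sum_le_sum fun j h ↦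
      smul_le_smul_of_nonneg_left (hj j h) (by positivity)).trans_eq ?_)
    rw [← Finset.sum_smul, hcard, one_smul]
  have hlim : Filter.Tendsto (fun n : ℕ ↦ 1 / ((n : ℝ) + 1)) Filter.atTop (nhds 0) :=
    tendsto_one_div_add_atTop_nhds_zero_nat
  have hlim' : Filter.Tendsto (fun n : ℕ ↦ (1 - 1 / ((n : ℝ) + 1) / δ₀) * κ +
      1 / ((n : ℝ) + 1) / δ₀ * b) Filter.atTop (nhds ((1 - 0 / δ₀) * κ + 0 / δ₀ * b)) :=
    (((hlim.div_const δ₀).const_sub 1).mul_const κ).add ((hlim.div_const δ₀).mul_const b)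
  rw [zero_div, sub_zero, one_mul, zero_mul, add_zero] at hlim'
  exact ge_of_tendsto hlim' ((hlim.eventually_le_const hδ₀).mono hbound)

theorem IsRegularPD.reApplyInnerSelf_map_star_conj_add_le (hH : ¬ FiniteDimensional ℂ H)
    (hreg : IsRegularPD F) (hconv : IsConvexPD F) {c d : H →L[ℂ] H}
    (hcd : star c * c + star d * d = 1) {x y : Fin k → (H →L[ℂ] H)}
    (hx : ∀ i, IsPosDefInv (x i)) (hy : ∀ i, IsPosDefInv (y i)) (ξ : H) :
    (F fun i ↦ star c * x i * c + star d * y i * d).reApplyInnerSelf ξ ≤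
      (star c * F x * c + star d * F y * d).reApplyInnerSelf ξ := by
  obtain ⟨E, hfin, hE, hξE, hTE⟩ := exists_filtration
    (Sum.elim (fun i ↦ star c * x i * c + star d * y i * d) ![c, d] :
      Fin k ⊕ Fin 2 → (H →L[ℂ] H)) ξ
  exact hreg.reApplyInnerSelf_map_le hconv E hE (fun i ↦ (hx i).star_conj_add (hy i) hcd)
    (fun i n v hv ↦ hTE n (.inl i) v hv) hξE fun j w hw ↦
      reApplyInnerSelf_le_of_compress_le isStarProjection_starProjection.isSelfAdjoint
        (Submodule.starProjection_eq_self_iff.2 (hξE j))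
        (hreg.compress_map_le hH hconv (E j) (E (j + 1)) (hE j.le_succ)
          (fun v hv ↦ hTE j (.inr 0) v hv) (fun v hv ↦ hTE j (.inr 1) v hv) hcd hx hy hw)

/-- **Jensen's inequality** for convex regular maps. -/
theorem IsRegularPD.map_star_conj_add_le (hH : ¬ FiniteDimensional ℂ H) (hreg : IsRegularPD F)
    (hsa : ∀ A : Fin k → (H →L[ℂ] H), (∀ i, IsPosDefInv (A i)) → IsSelfAdjoint (F A))
    (hconv : IsConvexPD F) {c d : H →L[ℂ] H} (hcd : star c * c + star d * d = 1)
    {x y : Fin k → (H →L[ℂ] H)} (hx : ∀ i, IsPosDefInv (x i)) (hy : ∀ i, IsPosDefInv (y i)) :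
    F (fun i ↦ star c * x i * c + star d * y i * d) ≤ star c * F x * c + star d * F y * d := by
  have h1 := hsa _ fun i ↦ (hx i).star_conj_add (hy i) hcd
  have h2 := ((hsa x hx).conjugate' c).add ((hsa y hy).conjugate' d)
  refine (ContinuousLinearMap.le_def _ _).2
    ⟨ContinuousLinearMap.isSelfAdjoint_iff_isSymmetric.1 (h2.sub h1), fun ξ ↦ ?_⟩
  have := hreg.reApplyInnerSelf_map_star_conj_add_le hH hconv hcd hx hy ξ
  rw [← sub_nonneg] at this
  simpa [ContinuousLinearMap.reApplyInnerSelf_apply, inner_sub_left] using this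

end Jensen

section Sqrt

theorem IsPosDefInv.sqrt_mul_sqrt_inverse {a : H →L[ℂ] H} (ha : IsPosDefInv a) :
    CFC.sqrt a * CFC.sqrt (Ring.inverse a) = 1 ∧ CFC.sqrt (Ring.inverse a) * CFC.sqrt a = 1 := by
  have hu : IsUnit (CFC.sqrt a) := (CFC.isUnit_sqrt_iff a ha.1).2 ha.2
  rw [CFC.sqrt_ringInverse]
  exact ⟨Ring.mul_inverse_cancel _ hu, Ring.inverse_mul_cancel _ hu⟩

theorem star_sqrt (a : H →L[ℂ] H) : star (CFC.sqrt a) = CFC.sqrt a :=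
  IsSelfAdjoint.of_nonneg (CFC.sqrt_nonneg a)

theorem IsPosDefInv.sqrt_inverse_conj {a x : H →L[ℂ] H} (ha : IsPosDefInv a)
    (hx : IsPosDefInv x) :
    IsPosDefInv (CFC.sqrt (Ring.inverse a) * x * CFC.sqrt (Ring.inverse a)) := by
  have hu : IsUnit (CFC.sqrt (Ring.inverse a)) :=
    ⟨⟨_, _, ha.sqrt_mul_sqrt_inverse.2, ha.sqrt_mul_sqrt_inverse.1⟩, rfl⟩
  refine ⟨?_, (hu.mul hx.2).mul hu⟩
  simpa only [star_sqrt] using star_left_conjugate_nonneg hx.1 (CFC.sqrt (Ring.inverse a))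

end Sqrt

/-- **Convexity of the perspective.** The perspective of a convex regular mapping of `k`-tuples
of positive definite invertible operators into self-adjoint operators is convex in all `k+1`
variables. -/
theorem perspective_convex
    (hH : ¬ FiniteDimensional ℂ H) {k : ℕ}
    (F : (Fin k → (H →L[ℂ] H)) → (H →L[ℂ] H))
    (hreg : IsRegularPD F)
    (hsa : ∀ A : Fin k → (H →L[ℂ] H), (∀ i, IsPosDefInv (A i)) → IsSelfAdjoint (F A))
    (hconv : ∀ A B : Fin k → (H →L[ℂ] H),
      (∀ i, IsPosDefInv (A i)) → (∀ i, IsPosDefInv (B i)) →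
      ∀ t : ℝ, 0 ≤ t → t ≤ 1 →
        F (fun i => t • A i + (1 - t) • B i) ≤ t • F A + (1 - t) • F B)
    (A B : Fin k → (H →L[ℂ] H)) (A' B' : H →L[ℂ] H)
    (hA : ∀ i, IsPosDefInv (A i)) (hB : ∀ i, IsPosDefInv (B i))
    (hA' : IsPosDefInv A') (hB' : IsPosDefInv B')
    (t : ℝ) (ht0 : 0 ≤ t) (ht1 : t ≤ 1) :
    perspective F (fun i => t • A i + (1 - t) • B i) (t • A' + (1 - t) • B') ≤
      t • perspective F A A' + (1 - t) • perspective F B B' := by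
  have hC : IsPosDefInv (t • A' + (1 - t) • B') :=
    hA'.convex_comb hB' ht0 (sub_nonneg.2 ht1) (add_sub_cancel _ _)
  obtain ⟨ha1, ha2⟩ := hA'.sqrt_mul_sqrt_inverse
  obtain ⟨hb1, hb2⟩ := hB'.sqrt_mul_sqrt_inverse
  obtain ⟨hc1, hc2⟩ := hC.sqrt_mul_sqrt_inverse
  have hcc := CFC.sqrt_mul_sqrt_self _ hC.1
  have haa := CFC.sqrt_mul_sqrt_self _ hA'.1
  have hbb := CFC.sqrt_mul_sqrt_self _ hB'.1
  have hx := fun i ↦ hA'.sqrt_inverse_conj (hA i)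
  have hy := fun i ↦ hB'.sqrt_inverse_conj (hB i)
  have hsa' := star_sqrt A'
  have hsb' := star_sqrt B'
  have hsc := star_sqrt (t • A' + (1 - t) • B')
  have hsci := star_sqrt (Ring.inverse (t • A' + (1 - t) • B'))
  simp only [perspective]
  generalize CFC.sqrt (Ring.inverse A') = ai at *
  generalize CFC.sqrt (Ring.inverse B') = bi at *
  generalize CFC.sqrt (Ring.inverse (t • A' + (1 - t) • B')) = ci at *
  generalize CFC.sqrt (t • A' + (1 - t) • B') = c at *
  generalize CFC.sqrt A' = a at *
  generalize CFC.sqrt B' = b at *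
  have htt : √t * √t = t := Real.mul_self_sqrt ht0
  have htt' : √(1 - t) * √(1 - t) = 1 - t := Real.mul_self_sqrt (sub_nonneg.2 ht1)
  have hsum : star (√t • (a * ci)) * (√t • (a * ci)) +
      star (√(1 - t) • (b * ci)) * (√(1 - t) • (b * ci)) = 1 := by
    calc _ = ci * (t • (a * a) + (1 - t) • (b * b)) * ci := by
          simp only [star_smul, star_mul, star_trivial, hsa', hsb', hsci, smul_smul, htt,
            htt', mul_add, add_mul, mul_smul_comm, smul_mul_assoc, mul_assoc]
      _ = (ci * c) * (c * ci) := by rw [haa, hbb, ← hcc]; simp only [mul_assoc]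
      _ = 1 := by rw [hc1, hc2, one_mul]
  have hJ := hreg.map_star_conj_add_le hH hsa hconv hsum hx hy
  have hz : (fun i ↦ star (√t • (a * ci)) * (ai * A i * ai) * (√t • (a * ci)) +
      star (√(1 - t) • (b * ci)) * (bi * B i * bi) * (√(1 - t) • (b * ci))) =
      fun i ↦ ci * (t • A i + (1 - t) • B i) * ci := by
    funext i
    simp only [star_smul, star_mul, star_trivial, hsa', hsb', hsci, mul_add, add_mul,
      mul_smul_comm, smul_mul_assoc, mul_assoc, smul_smul, htt, htt',
      mul_mul_cancel_left_of_eq ha1, mul_mul_cancel_left_of_eq ha2,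
      mul_mul_cancel_left_of_eq hb1, mul_mul_cancel_left_of_eq hb2, one_mul]
  rw [hz] at hJ
  refine (IsSelfAdjoint.conjugate_le_conjugate hJ hsc).trans_eq ?_
  simp only [star_smul, star_mul, star_trivial, hsa', hsb', hsci, mul_add, add_mul,
    mul_smul_comm, smul_mul_assoc, mul_assoc, smul_smul, htt, htt',
    mul_mul_cancel_left_of_eq hc1, hc2, one_mul, mul_one]
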